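/- Under the assumptions of the restricted approximation theorem (P is V-uniformly ergodic with constants C, α; PV ≤ δV + L with δ ∈ [0,1), L ≥ 1; P̃(x, B_R) = 1 for all x; R·Δ(R) ≤ (1−δ)/2 where Δ(R) := sup_{x∈B_R} ‖P_R(x,·) − P̃(x,·)‖_tv / V(x); p_0 = p̃_0; κ := max{p̃_0(V), L/(1−δ)}), for all R ≥ e and n ∈ ℕ: ‖p_n − p̃_n‖_tv ≤ (33 C (L+1) κ / (1−α)) · (log R)/R. -/

import Mathlib

open MeasureTheory ProbabilityTheory

/-- The `V`-weighted distance `‖μ − ν‖_V = sup_{|f| ≤ V} |μ(f) − ν(f)|`. -/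
noncomputable def vDist {G : Type*} [MeasurableSpace G] (V : G → ℝ) (μ ν : Measure G) : ℝ :=
  ⨆ f : {f : G → ℝ // Measurable f ∧ ∀ x, |f x| ≤ V x},
    |(∫ x, (f : G → ℝ) x ∂μ) - ∫ x, (f : G → ℝ) x ∂ν|

/-- `n`-fold application of a Markov kernel to a measure: `iterK P n μ = μ Pⁿ`. -/
noncomputable def iterK {G : Type*} [MeasurableSpace G] (P : Kernel G G) :
    ℕ → Measure G → Measure G
  | 0, μ => μ
  | n + 1, μ => (iterK P n μ).bind (fun x => P x)

/-- The restriction `P_R(x,·) = P(x, · ∩ B) + P(x,Bᶜ) δ_x` of a kernel to a set `B`. -/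
noncomputable def restrictKer {G : Type*} [MeasurableSpace G]
    (P : Kernel G G) (B : Set G) (x : G) : Measure G :=
  (P x).restrict B + ((P x) Bᶜ) • Measure.dirac x

section

open Filter Topology

variable {G : Type*} [MeasurableSpace G]

lemma abs_integral_le_integral {μ : Measure G} {f g : G → ℝ} (hg : Integrable g μ)
    (hfg : ∀ x, |f x| ≤ g x) : |∫ x, f x ∂μ| ≤ ∫ x, g x ∂μ :=
  norm_integral_le_of_norm_le (f := f) hg (ae_of_all _ hfg)

lemma bddAbove_integral_sub {V : G → ℝ} {μ ν : Measure G} (hμ : Integrable V μ)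
    (hν : Integrable V ν) :
    BddAbove (Set.range fun f : {f : G → ℝ // Measurable f ∧ ∀ x, |f x| ≤ V x} =>
      |(∫ x, (f : G → ℝ) x ∂μ) - ∫ x, (f : G → ℝ) x ∂ν|) := by
  refine ⟨(∫ x, V x ∂μ) + ∫ x, V x ∂ν, ?_⟩
  rintro _ ⟨⟨f, hf, hfV⟩, rfl⟩
  exact (abs_sub _ _).trans
    (add_le_add (abs_integral_le_integral hμ hfV) (abs_integral_le_integral hν hfV))

lemma abs_integral_sub_le_vDist {V : G → ℝ} {μ ν : Measure G} (hμ : Integrable V μ)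
    (hν : Integrable V ν) {f : G → ℝ} (hf : Measurable f) (hfV : ∀ x, |f x| ≤ V x) :
    |(∫ x, f x ∂μ) - ∫ x, f x ∂ν| ≤ vDist V μ ν :=
  le_ciSup (bddAbove_integral_sub hμ hν) ⟨f, hf, hfV⟩

lemma abs_integral_sub_le_mul_vDist_one {μ ν : Measure G} [IsProbabilityMeasure μ]
    [IsProbabilityMeasure ν] {c : ℝ} (hc : 0 ≤ c) {f : G → ℝ} (hf : Measurable f)
    (hfc : ∀ x, |f x| ≤ c) :
    |(∫ x, f x ∂μ) - ∫ x, f x ∂ν| ≤ c * vDist (fun _ => 1) μ ν := by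
  rcases hc.eq_or_lt with rfl | hc
  · have h0 : ∀ x, f x = 0 := fun x => abs_nonpos_iff.1 (hfc x)
    simp [h0]
  have h := abs_integral_sub_le_vDist (V := fun _ => 1) (μ := μ) (ν := ν)
    (integrable_const _) (integrable_const _) (hf.const_mul c⁻¹) (fun x => by
      rw [abs_mul, abs_of_pos (inv_pos.2 hc), inv_mul_le_iff₀ hc, mul_one]
      exact hfc x)
  rwa [integral_const_mul, integral_const_mul, ← mul_sub, abs_mul, abs_of_pos (inv_pos.2 hc),
    inv_mul_le_iff₀ hc] at h

lemma integrable_of_abs_le {μ : Measure G} [IsFiniteMeasure μ] {f : G → ℝ} (hf : Measurable f)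
    {c : ℝ} (hfc : ∀ x, |f x| ≤ c) : Integrable f μ :=
  .of_bound hf.aestronglyMeasurable c (ae_of_all _ hfc)

lemma abs_integral_le_of_abs_le {μ : Measure G} [IsProbabilityMeasure μ] {f : G → ℝ}
    {c : ℝ} (hfc : ∀ x, |f x| ≤ c) : |∫ x, f x ∂μ| ≤ c := by
  simpa using norm_integral_le_of_norm_le_const (μ := μ) (f := f) (ae_of_all _ hfc)

lemma measurable_integral_kernel (P : Kernel G G) [IsMarkovKernel P] {f : G → ℝ}
    (hf : Measurable f) : Measurable fun x => ∫ y, f y ∂(P x) :=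
  (hf.stronglyMeasurable.integral_kernel (κ := P)).measurable

instance (P : Kernel G G) [IsMarkovKernel P] (n : ℕ) (μ : Measure G) [IsProbabilityMeasure μ] :
    IsProbabilityMeasure (iterK P n μ) := by
  induction n with
  | zero => assumption
  | succ n ih => exact inferInstanceAs (IsProbabilityMeasure ((iterK P n μ).bind P))

/-- `iterInt P n f = Pⁿ f`, the `n`-fold action of a kernel on functions. -/
noncomputable def iterInt (P : Kernel G G) : ℕ → (G → ℝ) → G → ℝ
  | 0, f => f
  | n + 1, f => fun x => ∫ y, iterInt P n f y ∂(P x)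

lemma measurable_iterInt (P : Kernel G G) [IsMarkovKernel P] (n : ℕ) {f : G → ℝ}
    (hf : Measurable f) : Measurable (iterInt P n f) := by
  induction n with
  | zero => exact hf
  | succ n ih => exact measurable_integral_kernel P ih

lemma abs_iterInt_le (P : Kernel G G) [IsMarkovKernel P] (n : ℕ) {f : G → ℝ} {c : ℝ}
    (hfc : ∀ x, |f x| ≤ c) (x : G) : |iterInt P n f x| ≤ c := by
  induction n generalizing x with
  | zero => exact hfc x
  | succ n ih => exact abs_integral_le_of_abs_le ih

lemma integral_bind_kernel (P : Kernel G G) (μ : Measure G) {f : G → ℝ}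
    (hf : Integrable f (μ.bind P)) : ∫ x, f x ∂(μ.bind P) = ∫ x, ∫ y, f y ∂(P x) ∂μ := by
  rw [Measure.comp_eq_comp_const_apply] at hf ⊢
  rw [Kernel.integral_comp hf, Kernel.const_apply]

lemma integral_bind_of_abs_le (P : Kernel G G) [IsMarkovKernel P] (μ : Measure G)
    [IsProbabilityMeasure μ] {f : G → ℝ} (hf : Measurable f) {c : ℝ} (hfc : ∀ x, |f x| ≤ c) :
    ∫ x, f x ∂(μ.bind fun x => P x) = ∫ x, ∫ y, f y ∂(P x) ∂μ :=
  integral_bind_kernel P μ (integrable_of_abs_le hf hfc)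

lemma integral_iterK (P : Kernel G G) [IsMarkovKernel P] (n k : ℕ) (μ : Measure G)
    [IsProbabilityMeasure μ] {f : G → ℝ} (hf : Measurable f) {c : ℝ} (hfc : ∀ x, |f x| ≤ c) :
    ∫ x, iterInt P k f x ∂(iterK P n μ) = ∫ x, iterInt P (k + n) f x ∂μ := by
  induction n generalizing k with
  | zero => rfl
  | succ n ih =>
    rw [iterK, integral_bind_of_abs_le P _ (measurable_iterInt P k hf) (abs_iterInt_le P k hfc),
      ← Nat.succ_add_eq_add_succ, ← ih]
    rfl

/-- A drift condition holding `μ`-almost everywhere propagates integrability of `V`. -/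
lemma integrable_bind_of_drift (P : Kernel G G) [IsMarkovKernel P] (μ : Measure G)
    [IsProbabilityMeasure μ] {V : G → ℝ} (hVmeas : Measurable V) (hV : ∀ x, 0 ≤ V x)
    (hVint : ∀ x, Integrable V (P x)) (hμ : Integrable V μ) {a b : ℝ}
    (hdrift : ∀ᵐ x ∂μ, ∫ y, V y ∂(P x) ≤ a * V x + b) :
    Integrable V (μ.bind fun x => P x) ∧
      ∫ x, V x ∂(μ.bind fun x => P x) ≤ a * (∫ x, V x ∂μ) + b := by
  have hab : Integrable (fun x => a * V x + b) μ := (hμ.const_mul a).add (integrable_const b)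
  have h1 : Integrable (fun x => ∫ y, V y ∂(P x)) μ := by
    refine hab.mono' (measurable_integral_kernel P hVmeas).aestronglyMeasurable ?_
    filter_upwards [hdrift] with x hx
    rwa [Real.norm_of_nonneg (integral_nonneg hV)]
  have h2 : Integrable V (μ.bind P) := by
    rw [Measure.integrable_comp_iff hVmeas.aestronglyMeasurable]
    refine ⟨ae_of_all _ hVint, ?_⟩
    simpa only [Real.norm_of_nonneg (hV _)] using h1
  refine ⟨h2, ?_⟩
  rw [show (μ.bind fun x => P x) = μ.bind P from rfl, integral_bind_kernel P μ h2]
  refine (integral_mono_ae h1 hab hdrift).trans_eq ?_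
  rw [integral_add (hμ.const_mul a) (integrable_const b), integral_const_mul]
  simp

lemma integrable_iterK (P : Kernel G G) [IsMarkovKernel P] (μ : Measure G)
    [IsProbabilityMeasure μ] {V : G → ℝ} (hVmeas : Measurable V) (hV : ∀ x, 0 ≤ V x)
    (hVint : ∀ x, Integrable V (P x)) (hμ : Integrable V μ) {a b : ℝ}
    (hdrift : ∀ x, ∫ y, V y ∂(P x) ≤ a * V x + b) (n : ℕ) : Integrable V (iterK P n μ) := by
  induction n with
  | zero => exact hμ
  | succ n ih =>
    exact (integrable_bind_of_drift P _ hVmeas hV hVint ih (ae_of_all _ hdrift)).1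

/-- Under a geometric drift condition `V` is integrable for every invariant probability. -/
lemma integrable_of_invariant (P : Kernel G G) [IsMarkovKernel P] (π : Measure G)
    [IsProbabilityMeasure π] (hstat : π.bind (fun x => P x) = π) {V : G → ℝ}
    (hVmeas : Measurable V) (hV : ∀ x, 0 ≤ V x) (hVint : ∀ x, Integrable V (P x)) {δ L : ℝ}
    (hδ0 : 0 ≤ δ) (hδ1 : δ < 1) (hL : 0 ≤ L)
    (hlyap : ∀ x, ∫ y, V y ∂(P x) ≤ δ * V x + L) : Integrable V π := by
  set K := L / (1 - δ) with hK
  have hKL : L = K * (1 - δ) := by rw [hK]; field_simp [(sub_pos.2 hδ1).ne']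
  have hK0 : 0 ≤ K := div_nonneg hL (sub_pos.2 hδ1).le
  let u (M : ℝ) (n : ℕ) (x : G) : ℝ := min (δ ^ n * V x + K * (1 - δ ^ n)) M
  have hpow (n : ℕ) : 0 ≤ δ ^ n ∧ δ ^ n ≤ 1 := ⟨pow_nonneg hδ0 n, pow_le_one₀ hδ0 hδ1.le⟩
  have hu_meas (M n) : Measurable (u M n) :=
    ((hVmeas.const_mul _).add_const _).min measurable_const
  have hu_bdd {M : ℝ} (hM : 0 ≤ M) (n x) : |u M n x| ≤ M := by
    rw [abs_of_nonneg]
    · exact min_le_right _ _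
    · refine le_min (add_nonneg (mul_nonneg (hpow n).1 (hV x)) (mul_nonneg hK0 ?_)) hM
      linarith [(hpow n).2]
  have hstep {M : ℝ} (hM : 0 ≤ M) (n) : ∫ x, u M n x ∂π ≤ ∫ x, u M (n + 1) x ∂π := by
    conv_lhs => rw [← hstat]
    rw [integral_bind_of_abs_le P π (hu_meas M n) (hu_bdd hM n)]
    refine integral_mono (integrable_of_abs_le (measurable_integral_kernel P (hu_meas M n))
      fun x => abs_integral_le_of_abs_le (hu_bdd hM n))
      (integrable_of_abs_le (hu_meas _ _) (hu_bdd hM _)) fun x => ?_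
    refine le_min ?_ ((le_abs_self _).trans (abs_integral_le_of_abs_le (hu_bdd hM n)))
    have hi : Integrable (fun y => δ ^ n * V y) (P x) := (hVint x).const_mul _
    calc ∫ y, u M n y ∂(P x) ≤ ∫ y, (δ ^ n * V y + K * (1 - δ ^ n)) ∂(P x) :=
          integral_mono (integrable_of_abs_le (hu_meas M n) (hu_bdd hM n))
            (hi.add (integrable_const _)) fun y => min_le_left _ _
      _ = δ ^ n * (∫ y, V y ∂(P x)) + K * (1 - δ ^ n) := by
          rw [integral_add hi (integrable_const _), integral_const_mul]; simp
      _ ≤ δ ^ n * (δ * V x + L) + K * (1 - δ ^ n) := by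
          gcongr
          exact hlyap x
      _ = δ ^ (n + 1) * V x + K * (1 - δ ^ (n + 1)) := by rw [hKL]; ring
  have hmin {M : ℝ} (hM : 0 ≤ M) : ∫ x, min (V x) M ∂π ≤ K := by
    have hle (n) : ∫ x, min (V x) M ∂π ≤ ∫ x, u M n x ∂π := by
      induction n with
      | zero => simp [u]
      | succ n ih => exact ih.trans (hstep hM n)
    have hδn : Tendsto (fun n => δ ^ n) atTop (𝓝 0) := tendsto_pow_atTop_nhds_zero_of_lt_one hδ0 hδ1
    have hlim : Tendsto (fun n => ∫ x, u M n x ∂π) atTop (𝓝 (∫ _, min K M ∂π)) := by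
      refine tendsto_integral_of_dominated_convergence (fun _ => M)
        (fun n => (hu_meas M n).aestronglyMeasurable) (integrable_const _)
        (fun n => ae_of_all _ (hu_bdd hM n)) (ae_of_all _ fun x => ?_)
      have := ((hδn.mul_const (V x)).add ((hδn.const_sub 1).const_mul K)).min
        (tendsto_const_nhds (x := M))
      simpa [u] using this
    refine (ge_of_tendsto' hlim hle).trans ?_
    simp
  refine ⟨hVmeas.aestronglyMeasurable, ?_⟩
  rw [hasFiniteIntegral_iff_ofReal (ae_of_all _ hV)]
  refine lt_of_le_of_lt ?_ (ENNReal.ofReal_lt_top (r := K))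
  have hfatou := lintegral_liminf_le (μ := π) (u := atTop)
    (f := fun (M : ℕ) x => ENNReal.ofReal (min (V x) M))
    fun M => (hVmeas.min measurable_const).ennreal_ofReal
  have hlim (x) : liminf (fun M : ℕ => ENNReal.ofReal (min (V x) M)) atTop
      = ENNReal.ofReal (V x) := by
    refine Tendsto.liminf_eq (tendsto_const_nhds.congr' ?_)
    obtain ⟨N, hN⟩ := exists_nat_ge (V x)
    filter_upwards [eventually_ge_atTop N] with M hM
    rw [min_eq_left (hN.trans (by exact_mod_cast hM))]
  simp only [hlim] at hfatou
  refine hfatou.trans (liminf_le_of_le (by isBoundedDefault) fun b hb => ?_)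
  obtain ⟨M, hM⟩ := hb.exists
  refine hM.trans ?_
  have h0 (x : G) : 0 ≤ min (V x) M := le_min (hV x) M.cast_nonneg
  rw [← ofReal_integral_eq_lintegral_ofReal _ (ae_of_all _ h0)]
  · exact ENNReal.ofReal_le_ofReal (hmin M.cast_nonneg)
  · exact integrable_of_abs_le (hVmeas.min measurable_const) (c := M)
      fun x => by rw [abs_of_nonneg (h0 x)]; exact min_le_right _ _

lemma isProbabilityMeasure_restrictKer (P : Kernel G G) [IsMarkovKernel P] {B : Set G}
    (hB : MeasurableSet B) (x : G) : IsProbabilityMeasure (restrictKer P B x) :=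
  ⟨by simp [restrictKer, prob_add_prob_compl hB]⟩

lemma integral_restrictKer (P : Kernel G G) [IsMarkovKernel P] (B : Set G) (x : G) {f : G → ℝ}
    (hf : Measurable f) (hfi : Integrable f (P x)) :
    ∫ y, f y ∂(restrictKer P B x) = (∫ y in B, f y ∂(P x)) + (P x).real Bᶜ * f x := by
  have hd : Integrable f (Measure.dirac x) := integrable_dirac' hf.stronglyMeasurable (by simp)
  rw [restrictKer, integral_add_measure hfi.integrableOn
    (hd.smul_measure (measure_ne_top _ _)), integral_smul_measure,
    integral_dirac' _ _ hf.stronglyMeasurable]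
  rfl

lemma abs_setIntegral_add_sub_le (P Q : Kernel G G) [IsMarkovKernel P] [IsMarkovKernel Q]
    {B : Set G} (hB : MeasurableSet B) {x : G} (hx : x ∈ B) (hQ : ∀ᵐ y ∂(Q x), y ∈ B) {D : ℝ}
    (hD : vDist (fun _ => 1) (restrictKer P B x) (Q x) ≤ D) {g : G → ℝ} (hg : Measurable g)
    (hgi : Integrable g (P x)) {c : ℝ} (hc : 0 ≤ c) (hgc : ∀ y ∈ B, |g y| ≤ c) :
    |(∫ y in B, g y ∂(P x)) + (P x).real Bᶜ * g x - ∫ y, g y ∂(Q x)| ≤ c * D := by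
  have := isProbabilityMeasure_restrictKer P hB x
  have h := abs_integral_sub_le_mul_vDist_one (μ := restrictKer P B x) (ν := Q x) hc
    (hg.indicator hB) (fun y => by
      by_cases hy : y ∈ B
      · simpa [hy] using hgc y hy
      · simpa [hy] using hc)
  rw [integral_restrictKer P B x (hg.indicator hB) (hgi.indicator hB),
    setIntegral_indicator hB, Set.inter_self, Set.indicator_of_mem hx] at h
  have hcongr : ∫ y, B.indicator g y ∂(Q x) = ∫ y, g y ∂(Q x) := by
    refine integral_congr_ae ?_
    filter_upwards [hQ] with y hy
    rw [Set.indicator_of_mem hy]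
  rw [hcongr] at h
  exact h.trans (mul_le_mul_of_nonneg_left hD hc)

lemma mul_measureReal_compl_le_setIntegral {μ : Measure G} [IsFiniteMeasure μ] {V : G → ℝ}
    (hVmeas : Measurable V) (hVint : Integrable V μ) (R : ℝ) :
    R * μ.real {y | V y ≤ R}ᶜ ≤ ∫ y in {y | V y ≤ R}ᶜ, V y ∂μ := by
  have hB : MeasurableSet {y | V y ≤ R}ᶜ := (measurableSet_le hVmeas measurable_const).compl
  have h := setIntegral_mono_on (μ := μ) (f := fun _ => R) (integrable_const R).integrableOn
    hVint.integrableOn hB fun y hy => (not_le.1 (Set.mem_ofPred.not.1 hy)).le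
  simpa [mul_comm] using h

/-- The restricted perturbation inherits a drift condition on the restriction set. -/
lemma integral_le_drift_of_restrictKer_close (P Q : Kernel G G) [IsMarkovKernel P]
    [IsMarkovKernel Q] {V : G → ℝ} (hVmeas : Measurable V) (hV : ∀ x, 0 ≤ V x) {R : ℝ}
    (hR : 0 ≤ R) {x : G} (hVint : Integrable V (P x)) {δ L : ℝ}
    (hlyap : ∫ y, V y ∂(P x) ≤ δ * V x + L) (hx : V x ≤ R) (hQ : ∀ᵐ y ∂(Q x), V y ≤ R) {Δ : ℝ}
    (hΔ : vDist (fun _ => 1) (restrictKer P {y | V y ≤ R} x) (Q x) ≤ Δ * V x)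
    (hRΔ : R * Δ ≤ (1 - δ) / 2) :
    ∫ y, V y ∂(Q x) ≤ (1 + δ) / 2 * V x + L := by
  have hB : MeasurableSet {y | V y ≤ R} := measurableSet_le hVmeas measurable_const
  have h := abs_setIntegral_add_sub_le P Q hB hx hQ hΔ hVmeas hVint hR
    fun y hy => by rw [abs_of_nonneg (hV y)]; exact hy
  have hsplit := integral_add_compl hB hVint
  have hmarkov := mul_measureReal_compl_le_setIntegral hVmeas hVint R
  have hxR : (P x).real {y | V y ≤ R}ᶜ * V x ≤ R * (P x).real {y | V y ≤ R}ᶜ := by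
    rw [mul_comm]
    gcongr
  have hΔV : R * (Δ * V x) ≤ (1 - δ) / 2 * V x := by
    rw [← mul_assoc]
    exact mul_le_mul_of_nonneg_right hRΔ (hV x)
  linarith [neg_abs_le ((∫ y in {y | V y ≤ R}, V y ∂(P x)) + (P x).real {y | V y ≤ R}ᶜ * V x
    - ∫ y, V y ∂(Q x))]

lemma integral_sub_eq_setIntegral_compl_sub (P Q : Kernel G G) {B : Set G}
    (hB : MeasurableSet B) {x : G} {g : G → ℝ} (hg : Integrable g (P x)) :
    (∫ y, g y ∂(P x)) - ∫ y, g y ∂(Q x) = (∫ y in Bᶜ, g y ∂(P x)) - (P x).real Bᶜ * g x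
      + ((∫ y in B, g y ∂(P x)) + (P x).real Bᶜ * g x - ∫ y, g y ∂(Q x)) := by
  rw [← integral_add_compl hB hg]
  ring

/-- One-step perturbation bound for bounded test functions. -/
lemma abs_integral_sub_le_of_abs_le (P Q : Kernel G G) [IsMarkovKernel P]
    [IsMarkovKernel Q] {V : G → ℝ} (hVmeas : Measurable V) (hV : ∀ x, 0 ≤ V x) {R : ℝ}
    (hR : 0 < R) {x : G} (hVint : Integrable V (P x)) {δ L : ℝ} (hδ1 : δ ≤ 1)
    (hL : 0 ≤ L) (hlyap : ∫ y, V y ∂(P x) ≤ δ * V x + L) (hQ : ∀ᵐ y ∂(Q x), V y ≤ R) {Δ : ℝ}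
    (hΔ : V x ≤ R →
      vDist (fun _ => 1) (restrictKer P {y | V y ≤ R} x) (Q x) ≤ Δ * V x)
    (hRΔ : R * Δ ≤ (1 - δ) / 2) {g : G → ℝ} (hg : Measurable g) {a : ℝ} (ha : 0 ≤ a)
    (hga : ∀ y, |g y| ≤ a) :
    |(∫ y, g y ∂(P x)) - ∫ y, g y ∂(Q x)| ≤ 2 * (a / R) * (V x + L) := by
  by_cases hx : V x ≤ R
  · have hB : MeasurableSet {y | V y ≤ R} := measurableSet_le hVmeas measurable_const
    have h := abs_setIntegral_add_sub_le P Q hB hx hQ (hΔ hx) hg (integrable_of_abs_le hg hga) ha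
      fun y _ => hga y
    rw [integral_sub_eq_setIntegral_compl_sub P Q hB (integrable_of_abs_le hg hga)]
    have h1 : |∫ y in {y | V y ≤ R}ᶜ, g y ∂(P x)| ≤ a * (P x).real {y | V y ≤ R}ᶜ :=
      norm_setIntegral_le_of_norm_le_const (f := g) (measure_lt_top _ _) fun y _ => hga y
    have h2 : |(P x).real {y | V y ≤ R}ᶜ * g x| ≤ a * (P x).real {y | V y ≤ R}ᶜ := by
      rw [abs_mul, abs_of_nonneg measureReal_nonneg, mul_comm]
      gcongr
      exact hga x
    have h3 : (P x).real {y | V y ≤ R}ᶜ ≤ (δ * V x + L) / R := by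
      rw [le_div_iff₀' hR]
      refine (mul_measureReal_compl_le_setIntegral hVmeas hVint R).trans (le_trans ?_ hlyap)
      exact setIntegral_le_integral hVint (ae_of_all _ hV)
    have h4 : Δ * V x ≤ (1 - δ) / 2 * V x / R := by
      rw [le_div_iff₀' hR, ← mul_assoc]
      exact mul_le_mul_of_nonneg_right hRΔ (hV x)
    have h5 : a * (2 * ((δ * V x + L) / R) + (1 - δ) / 2 * V x / R)
        ≤ 2 * (a / R) * (V x + L) := by
      rw [show a * (2 * ((δ * V x + L) / R) + (1 - δ) / 2 * V x / R)
        = (a / R) * (2 * (δ * V x + L) + (1 - δ) / 2 * V x) by ring, mul_comm 2 (a / R), mul_assoc]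
      refine mul_le_mul_of_nonneg_left ?_ (div_nonneg ha hR.le)
      nlinarith [mul_nonneg (sub_nonneg.2 hδ1) (hV x)]
    have h6 := mul_le_mul_of_nonneg_left h3 ha
    have h7 := mul_le_mul_of_nonneg_left h4 ha
    refine (abs_add_le _ _).trans ((add_le_add ((abs_sub _ _).trans (add_le_add h1 h2)) h).trans ?_)
    linarith
  · refine (abs_sub _ _).trans ((add_le_add (abs_integral_le_of_abs_le hga)
      (abs_integral_le_of_abs_le hga)).trans ?_)
    have h1 : a ≤ a / R * (V x + L) := by
      rw [div_mul_eq_mul_div, le_div_iff₀ hR]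
      exact mul_le_mul_of_nonneg_left (by linarith) ha
    linarith

/-- One-step perturbation bound for test functions dominated by `V`. -/
lemma abs_integral_sub_le_of_abs_le_mul (P Q : Kernel G G) [IsMarkovKernel P]
    [IsMarkovKernel Q] {V : G → ℝ} (hVmeas : Measurable V) (hV : ∀ x, 0 ≤ V x) {R : ℝ}
    (hR : 0 < R) {x : G} (hVint : Integrable V (P x)) (hVintQ : Integrable V (Q x)) {δ L : ℝ} (hδ1 : δ ≤ 1)
    (hL : 0 ≤ L) (hlyap : ∫ y, V y ∂(P x) ≤ δ * V x + L) (hQ : ∀ᵐ y ∂(Q x), V y ≤ R) {Δ : ℝ}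
    (hΔ : V x ≤ R →
      vDist (fun _ => 1) (restrictKer P {y | V y ≤ R} x) (Q x) ≤ Δ * V x)
    (hRΔ : R * Δ ≤ (1 - δ) / 2) {g : G → ℝ} (hg : Measurable g) {b : ℝ} (hb : 0 ≤ b)
    (hgb : ∀ y, |g y| ≤ b * V y) :
    |(∫ y, g y ∂(P x)) - ∫ y, g y ∂(Q x)| ≤ 2 * b * (V x + L) := by
  by_cases hx : V x ≤ R
  · have hB : MeasurableSet {y | V y ≤ R} := measurableSet_le hVmeas measurable_const
    have hgi : Integrable g (P x) :=
      (hVint.const_mul b).mono' hg.aestronglyMeasurable (ae_of_all _ hgb)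
    have h := abs_setIntegral_add_sub_le P Q hB hx hQ (hΔ hx) hg hgi (mul_nonneg hb hR.le)
      fun y hy => (hgb y).trans (mul_le_mul_of_nonneg_left hy hb)
    rw [integral_sub_eq_setIntegral_compl_sub P Q hB hgi]
    have h1 : |∫ y in {y | V y ≤ R}ᶜ, g y ∂(P x)| ≤ b * ∫ y in {y | V y ≤ R}ᶜ, V y ∂(P x) := by
      rw [← integral_const_mul]
      exact abs_integral_le_integral (hVint.const_mul b).integrableOn hgb
    have h2 : |(P x).real {y | V y ≤ R}ᶜ * g x|
        ≤ b * (R * (P x).real {y | V y ≤ R}ᶜ) := by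
      rw [abs_mul, abs_of_nonneg measureReal_nonneg, mul_comm, ← mul_assoc]
      gcongr
      exact (hgb x).trans (mul_le_mul_of_nonneg_left hx hb)
    have h3 : ∫ y in {y | V y ≤ R}ᶜ, V y ∂(P x) ≤ δ * V x + L :=
      (setIntegral_le_integral hVint (ae_of_all _ hV)).trans hlyap
    have h4 := mul_measureReal_compl_le_setIntegral hVmeas hVint R
    have h5 : R * (Δ * V x) ≤ (1 - δ) / 2 * V x := by
      rw [← mul_assoc]
      exact mul_le_mul_of_nonneg_right hRΔ (hV x)
    have h6 : b * (2 * (δ * V x + L) + (1 - δ) / 2 * V x) ≤ 2 * b * (V x + L) := by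
      rw [mul_comm 2 b, mul_assoc]
      refine mul_le_mul_of_nonneg_left ?_ hb
      nlinarith [mul_nonneg (sub_nonneg.2 hδ1) (hV x)]
    have h7 := mul_le_mul_of_nonneg_left (h4.trans h3) hb
    have h8 := mul_le_mul_of_nonneg_left h3 hb
    have h9 := mul_le_mul_of_nonneg_left h5 hb
    refine (abs_add_le _ _).trans ((add_le_add ((abs_sub _ _).trans (add_le_add h1 h2)) h).trans ?_)
    linarith
  · have hbd (ρ : Measure G) (hρ : Integrable V ρ) : |∫ y, g y ∂ρ| ≤ b * ∫ y, V y ∂ρ := by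
      rw [← integral_const_mul]
      exact abs_integral_le_integral (hρ.const_mul b) hgb
    have hQV : ∫ y, V y ∂(Q x) ≤ V x := by
      refine (integral_mono_ae hVintQ (integrable_const R) hQ).trans ?_
      simpa using (not_le.1 hx).le
    refine (abs_sub _ _).trans ((add_le_add (hbd _ hVint) (hbd _ hVintQ)).trans ?_)
    have h1 : b * ((∫ y, V y ∂(P x)) + ∫ y, V y ∂(Q x)) ≤ b * (2 * (V x + L)) := by
      refine mul_le_mul_of_nonneg_left ?_ hb
      nlinarith [mul_nonneg (sub_nonneg.2 hδ1) (hV x)]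
    linarith

lemma abs_integral_iterInt_sub_le (P Q : Kernel G G) (μ : Measure G) (f : G → ℝ) {e : ℕ → ℝ}
    (hstep : ∀ k i, |(∫ x, iterInt P (k + 1) f x ∂(iterK Q i μ))
      - ∫ x, iterInt P k f x ∂(iterK Q (i + 1) μ)| ≤ e k) (n k : ℕ) :
    |(∫ x, iterInt P (k + n) f x ∂μ) - ∫ x, iterInt P k f x ∂(iterK Q n μ)|
      ≤ ∑ j ∈ Finset.range n, e (k + j) := by
  induction n generalizing k with
  | zero => simp [iterK]
  | succ n ih =>
    have h := ih (k + 1)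
    rw [Nat.succ_add_eq_add_succ] at h
    refine (abs_sub_le _ _ _).trans ((add_le_add h (hstep k n)).trans_eq ?_)
    rw [Finset.sum_range_succ']
    simp [add_assoc, add_comm 1]

lemma sum_min_geometric_le {C α R : ℝ} (hC : 1 ≤ C) (hα0 : 0 ≤ α) (hα1 : α < 1)
    (hR : Real.exp 1 ≤ R) (n : ℕ) :
    ∑ j ∈ Finset.range n, min (2 / R) (C * α ^ j) ≤ 5 * C / (1 - α) * (Real.log R / R) := by
  have hR0 : 0 < R := (Real.exp_pos 1).trans_le hR
  have hlog : 1 ≤ Real.log R := (Real.le_log_iff_exp_le hR0).2 hR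
  have hβ : 0 < 1 - α := sub_pos.2 hα1
  set N := ⌈Real.log R / (1 - α)⌉₊
  have hN1 : Real.log R / (1 - α) ≤ N := Nat.le_ceil _
  have hN2 : (N : ℝ) ≤ 2 * (Real.log R / (1 - α)) := by
    have h1 : 1 ≤ Real.log R / (1 - α) := by rw [le_div_iff₀ hβ]; linarith
    have h2 : (N : ℝ) < Real.log R / (1 - α) + 1 := Nat.ceil_lt_add_one (by linarith)
    linarith
  have hαN : α ^ N ≤ 1 / R := by
    calc α ^ N ≤ Real.exp (-(1 - α)) ^ N := by
          gcongr
          linarith [Real.add_one_le_exp (-(1 - α))]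
      _ = Real.exp (-(N * (1 - α))) := by rw [← Real.exp_nat_mul]; ring_nf
      _ ≤ Real.exp (-Real.log R) := by
          rw [div_le_iff₀ hβ] at hN1
          gcongr
      _ = 1 / R := by rw [Real.exp_neg, Real.exp_log hR0, one_div]
  have hgeom : ∑ j ∈ Finset.range n, α ^ j ≤ (1 - α)⁻¹ := by
    rw [← tsum_geometric_of_lt_one hα0 hα1]
    exact (summable_geometric_of_lt_one hα0 hα1).sum_le_tsum _ fun j _ => pow_nonneg hα0 j
  have hnonneg (j : ℕ) : 0 ≤ min (2 / R) (C * α ^ j) :=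
    le_min (by positivity) (by positivity)
  calc ∑ j ∈ Finset.range n, min (2 / R) (C * α ^ j)
      ≤ ∑ j ∈ Finset.range (N + n), min (2 / R) (C * α ^ j) :=
        Finset.sum_le_sum_of_subset_of_nonneg
          (Finset.range_mono (Nat.le_add_left n N)) fun j _ _ => hnonneg j
    _ ≤ ∑ _j ∈ Finset.range N, 2 / R + ∑ j ∈ Finset.range n, C * α ^ (N + j) := by
        rw [Finset.sum_range_add]
        gcongr
        · exact min_le_left _ _
        · exact min_le_right _ _
    _ = N * (2 / R) + C * (α ^ N * ∑ j ∈ Finset.range n, α ^ j) := by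
        simp [pow_add, Finset.mul_sum]
    _ ≤ 2 * (Real.log R / (1 - α)) * (2 / R) + C * (1 / R * (1 - α)⁻¹) := by
        gcongr
    _ = (4 * Real.log R + C) * (1 / (R * (1 - α))) := by field_simp; ring
    _ ≤ (5 * C * Real.log R) * (1 / (R * (1 - α))) := by
        gcongr
        nlinarith
    _ = 5 * C / (1 - α) * (Real.log R / R) := by field_simp

/-- Convergence of `Pᵏ f` towards `π(f)` under `V`-uniform ergodicity and drift. -/
lemma abs_iterInt_sub_integral_le (P : Kernel G G) [IsMarkovKernel P] (π : Measure G)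
    {V : G → ℝ} (hVmeas : Measurable V) (hV : ∀ x, 1 ≤ V x)
    (hVint : ∀ x, Integrable V (P x)) (hπ : Integrable V π) {a b : ℝ}
    (hdrift : ∀ x, ∫ y, V y ∂(P x) ≤ a * V x + b) {f : G → ℝ} (hf : Measurable f)
    (hf1 : ∀ x, |f x| ≤ 1) (k : ℕ) (x : G) :
    |iterInt P k f x - ∫ y, f y ∂π| ≤ vDist V (iterK P k (Measure.dirac x)) π := by
  have hV0 (x : G) : 0 ≤ V x := zero_le_one.trans (hV x)
  have h1 : ∫ y, f y ∂(iterK P k (Measure.dirac x)) = iterInt P k f x := by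
    rw [show ∫ y, f y ∂(iterK P k (Measure.dirac x)) = ∫ y, iterInt P (0 + k) f y ∂(.dirac x) from
      integral_iterK P k 0 (Measure.dirac x) hf hf1,
      integral_dirac' _ _ (measurable_iterInt P _ hf).stronglyMeasurable, zero_add]
  rw [← h1]
  refine abs_integral_sub_le_vDist ?_ hπ hf fun y => (hf1 y).trans (hV y)
  exact integrable_iterK P _ hVmeas hV0 hVint
    (integrable_dirac' hVmeas.stronglyMeasurable (by simp)) hdrift k

end

/-- restricted approximation theorem: if `P` is `V`-uniformly ergodic with
constants `C, α`, satisfies `PV ≤ δV + L`, the perturbed kernel `P̃` is concentrated on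
`B_R = {V ≤ R}`, `‖P_R(x,·) − P̃(x,·)‖_tv ≤ Δ V(x)` on `B_R` with `RΔ ≤ (1−δ)/2`, and
`p_0 = p̃_0`, then for `R ≥ e`:
`‖p_n − p̃_n‖_tv ≤ (33 C (L+1) κ / (1−α)) · (log R)/R`. -/
theorem restricted_approximation {G : Type*} [MeasurableSpace G]
    (P Pt : Kernel G G) [IsMarkovKernel P] [IsMarkovKernel Pt]
    (V : G → ℝ) (hVmeas : Measurable V) (hV : ∀ x, 1 ≤ V x)
    (π : Measure G) [IsProbabilityMeasure π]
    (hstat : π.bind (fun x => P x) = π)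
    (C α : ℝ) (hC : 1 ≤ C) (hα : α ∈ Set.Ico (0 : ℝ) 1)
    (herg : ∀ x n, vDist V (iterK P n (Measure.dirac x)) π ≤ C * V x * α ^ n)
    (δ L : ℝ) (hδ : δ ∈ Set.Ico (0 : ℝ) 1) (hL : 1 ≤ L)
    (hVint : ∀ x, Integrable V (P x)) (hVintT : ∀ x, Integrable V (Pt x))
    (hlyap : ∀ x, ∫ y, V y ∂(P x) ≤ δ * V x + L)
    (R : ℝ) (hR : Real.exp 1 ≤ R)
    (hPt : ∀ x, (Pt x) {y | V y ≤ R} = 1)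
    (Δ : ℝ) (hΔ0 : 0 ≤ Δ)
    (hΔ : ∀ x, V x ≤ R → vDist (fun _ => 1) (restrictKer P {y | V y ≤ R} x) (Pt x) ≤ Δ * V x)
    (hRΔ : R * Δ ≤ (1 - δ) / 2)
    (p0 : Measure G) [IsProbabilityMeasure p0] (hp0 : Integrable V p0)
    (n : ℕ) :
    vDist (fun _ => 1) (iterK P n p0) (iterK Pt n p0)
      ≤ 33 * C * (L + 1) * max (∫ x, V x ∂p0) (L / (1 - δ)) / (1 - α)
          * (Real.log R / R) := by
  obtain ⟨hα0, hα1⟩ := hα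
  obtain ⟨hδ0, hδ1⟩ := hδ
  have hR0 : 0 < R := (Real.exp_pos 1).trans_le hR
  have hV0 (x : G) : 0 ≤ V x := zero_le_one.trans (hV x)
  have hB : MeasurableSet {y | V y ≤ R} := measurableSet_le hVmeas measurable_const
  have hPt' (x : G) : ∀ᵐ y ∂(Pt x), V y ≤ R := (prob_compl_eq_zero_iff hB).2 (hPt x)
  have hπ : Integrable V π := integrable_of_invariant P π hstat hVmeas hV0 hVint hδ0 hδ1
    (by linarith) hlyap
  set κ := max (∫ x, V x ∂p0) (L / (1 - δ))
  have hκL : L ≤ κ * (1 - δ) := (div_le_iff₀ (sub_pos.2 hδ1)).1 (le_max_right _ _)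
  have hκ0 : 0 ≤ κ := (div_nonneg (by linarith) (sub_pos.2 hδ1).le).trans (le_max_right _ _)
  have hκL' : L ≤ κ := hκL.trans (mul_le_of_le_one_right hκ0 (by linarith))
  have hsupp (i : ℕ) : ∀ᵐ x ∂(iterK Pt (i + 1) p0), V x ≤ R :=
    Measure.ae_comp_of_ae_ae (κ := Pt) hB (ae_of_all _ hPt')
  have hPtV (x : G) (hx : V x ≤ R) : ∫ y, V y ∂(Pt x) ≤ (1 + δ) / 2 * V x + L :=
    integral_le_drift_of_restrictKer_close P Pt hVmeas hV0 hR0.le (hVint x) (hlyap x) hx (hPt' x)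
      (hΔ x hx) hRΔ
  have hmoment (i : ℕ) : Integrable V (iterK Pt i p0) ∧ ∫ x, V x ∂(iterK Pt i p0) ≤ 2 * κ := by
    have h0 : ∫ x, V x ∂p0 ≤ κ := le_max_left _ _
    induction i with
    | zero => exact ⟨hp0, by change ∫ x, V x ∂p0 ≤ _; linarith⟩
    | succ i ih =>
      cases i with
      | zero =>
        obtain ⟨h1, h2⟩ := integrable_bind_of_drift Pt p0 hVmeas hV0 hVintT hp0 (a := 1) (b := L)
          (ae_of_all _ fun x => by
            rcases le_or_gt (V x) R with hx | hx
            · nlinarith [hPtV x hx, hV0 x]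
            · have := integral_mono_ae (hVintT x) (integrable_const R) (hPt' x)
              simp only [integral_const, probReal_univ, smul_eq_mul, one_mul] at this
              linarith)
        exact ⟨h1, h2.trans (by linarith)⟩
      | succ i =>
        obtain ⟨h1, h2⟩ := integrable_bind_of_drift Pt _ hVmeas hV0 hVintT ih.1
          ((hsupp i).mono hPtV)
        refine ⟨h1, h2.trans ?_⟩
        nlinarith [ih.2]
  have hstep {f : G → ℝ} (hf : Measurable f) (hf1 : ∀ x, |f x| ≤ 1) (k i : ℕ) :
      |(∫ x, iterInt P (k + 1) f x ∂(iterK Pt i p0))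
        - ∫ x, iterInt P k f x ∂(iterK Pt (i + 1) p0)|
        ≤ 6 * κ * min (2 / R) (C * α ^ k) := by
    set m := min (2 / R) (C * α ^ k)
    have hm : 0 ≤ m := le_min (by positivity) (by positivity)
    have hT := measurable_iterInt P k hf
    have hTb := abs_iterInt_le P k hf1
    have hTi (ρ : Measure G) [IsProbabilityMeasure ρ] : Integrable (iterInt P k f) ρ :=
      integrable_of_abs_le hT hTb
    have hpt (x : G) : |(∫ y, iterInt P k f y ∂(P x)) - ∫ y, iterInt P k f y ∂(Pt x)|
        ≤ 2 * m * (V x + L) := by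
      set c := ∫ y, f y ∂π
      have hcent : (∫ y, iterInt P k f y ∂(P x)) - ∫ y, iterInt P k f y ∂(Pt x)
          = (∫ y, (iterInt P k f y - c) ∂(P x)) - ∫ y, (iterInt P k f y - c) ∂(Pt x) := by
        rw [integral_sub (hTi _) (integrable_const c), integral_sub (hTi _) (integrable_const c)]
        simp
      rw [hcent]
      have hg : Measurable fun y => iterInt P k f y - c := hT.sub_const c
      have hA := abs_integral_sub_le_of_abs_le P Pt hVmeas hV0 hR0 (hVint x) hδ1.le
        (by linarith) (hlyap x) (hPt' x) (hΔ x) hRΔ hg zero_le_two fun y => by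
          have := (abs_sub _ c).trans (add_le_add (hTb y) (abs_integral_le_of_abs_le hf1))
          linarith
      have hC' := abs_integral_sub_le_of_abs_le_mul P Pt hVmeas hV0 hR0 (hVint x) (hVintT x)
        hδ1.le (by linarith) (hlyap x) (hPt' x) (hΔ x) hRΔ hg
        (mul_nonneg (zero_le_one.trans hC) (pow_nonneg hα0 k)) fun y => by
          refine (abs_iterInt_sub_integral_le P π hVmeas hV hVint hπ hlyap hf hf1 k y).trans ?_
          exact (herg y k).trans_eq (by ring)
      rcases min_choice (2 / R) (C * α ^ k) with h | h
      · rwa [show m = 2 / R from h]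
      · rwa [show m = C * α ^ k from h]
    rw [iterK, integral_bind_of_abs_le Pt _ hT hTb]
    have hi (Q : Kernel G G) [IsMarkovKernel Q] :
        Integrable (fun x => ∫ y, iterInt P k f y ∂(Q x)) (iterK Pt i p0) :=
      integrable_of_abs_le (measurable_integral_kernel Q hT)
        fun x => abs_integral_le_of_abs_le hTb
    rw [show iterInt P (k + 1) f = fun x => ∫ y, iterInt P k f y ∂(P x) from rfl,
      ← integral_sub (hi P) (hi Pt)]
    obtain ⟨hVi, hVκ⟩ := hmoment i
    refine (abs_integral_le_integral ((hVi.add (integrable_const L)).const_mul (2 * m))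
      hpt).trans ?_
    rw [integral_const_mul, integral_add' hVi (integrable_const L)]
    simp only [integral_const, probReal_univ, smul_eq_mul, one_mul]
    nlinarith
  have : Nonempty {f : G → ℝ // Measurable f ∧ ∀ x, |f x| ≤ (fun _ => (1 : ℝ)) x} :=
    ⟨fun _ => 0, measurable_const, by simp⟩
  refine ciSup_le fun ⟨f, hf, hf1⟩ => ?_
  have htel := abs_integral_iterInt_sub_le P Pt p0 f (hstep hf hf1) n 0
  rw [← integral_iterK P n 0 p0 hf hf1, ← Finset.mul_sum] at htel
  simp only [zero_add] at htel
  refine htel.trans ?_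
  have hlog : 0 ≤ Real.log R / R :=
    div_nonneg (Real.log_nonneg ((Real.one_le_exp zero_le_one).trans hR)) hR0.le
  have hβ : 0 < 1 - α := sub_pos.2 hα1
  calc 6 * κ * ∑ j ∈ Finset.range n, min (2 / R) (C * α ^ j)
      ≤ 6 * κ * (5 * C / (1 - α) * (Real.log R / R)) := by
        gcongr
        exact sum_min_geometric_le hC hα0 hα1 hR n
    _ = 30 * C * 1 * κ / (1 - α) * (Real.log R / R) := by ring
    _ ≤ 33 * C * (L + 1) * κ / (1 - α) * (Real.log R / R) := by
        gcongr <;> linarith
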